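/- arXiv:2206.10115 — 3 statements merged into one kernel-verified Lean document; each statement's English description precedes it below -/
import Mathlib

section
/- Let R be a left and right noetherian ring. Suppose there exist an ordinal α and an assignment j that associates to every finitely generated right R-module M an ordinal j(M), invariant under isomorphism of modules, such that: (i) j(R/xR) = α for every cancellative nonunit x ∈ R; and (ii) j is finitely partitive on α, i.e., for every finitely generated right R-module M with j(M) = α there is a finite bound on the lengths n of chains of submodules M_0 ⊆ M_1 ⊆ ⋯ ⊆ M_n = M with j(M_{i+1}/M_i) = α for all 0 ≤ i < n. Then R is a BF-ring. -/
/-- An element `c` of a monoid is *cancellative* if it can be cancelled on both sides. -/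
def IsCancellative {R : Type*} [Monoid R] (c : R) : Prop :=
  (∀ x y : R, c * x = c * y → x = y) ∧ (∀ x y : R, x * c = y * c → x = y)

/-- The submonoid of cancellative elements of a monoid. -/
def cancellativeSubmonoid (R : Type*) [Monoid R] : Submonoid R where
  carrier := {c | IsCancellative c}
  one_mem' := ⟨fun x y h => by simpa using h, fun x y h => by simpa using h⟩
  mul_mem' := by
    rintro a b ⟨hal, har⟩ ⟨hbl, hbr⟩
    constructor
    · intro x y h
      exact hbl x y (hal (b * x) (b * y) (by rw [← mul_assoc, ← mul_assoc]; exact h))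
    · intro x y h
      exact har x y (hbr (x * a) (y * a) (by rw [mul_assoc, mul_assoc]; exact h))

/-- The set of lengths of factorizations of `a` into atoms (irreducible elements). -/
def mulLengthSet {H : Type*} [Monoid H] (a : H) : Set ℕ :=
  {k | ∃ l : List H, (∀ x ∈ l, Irreducible x) ∧ l.prod = a ∧ l.length = k}

/-- A monoid is *atomic* if every nonunit is a finite product of atoms. -/
def IsAtomicMonoid (H : Type*) [Monoid H] : Prop :=
  ∀ a : H, ¬ IsUnit a → ∃ l : List H, (∀ x ∈ l, Irreducible x) ∧ l.prod = a

/-- A monoid is a *BF-monoid* if it is atomic and all length sets are finite. -/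
def IsBFMonoid (H : Type*) [Monoid H] : Prop :=
  IsAtomicMonoid H ∧ ∀ a : H, (mulLengthSet a).Finite

/-- A ring is a *BF-ring* if its monoid of cancellative elements is a BF-monoid. -/
def IsBFRing (R : Type*) [Ring R] : Prop :=
  IsBFMonoid (cancellativeSubmonoid R)

universe u v

theorem mem_span_op {R : Type*} [Ring R] (x y : R) :
    y ∈ Submodule.span Rᵐᵒᵖ ({x} : Set R) ↔ ∃ r : R, x * r = y := by
  rw [Submodule.mem_span_singleton]
  constructor
  · rintro ⟨a, rfl⟩
    exact ⟨a.unop, rfl⟩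
  · rintro ⟨r, rfl⟩
    exact ⟨MulOpposite.op r, rfl⟩

/-- Left multiplication as a right-linear map. -/
def lmulOp {R : Type*} [Ring R] (p : R) : R →ₗ[Rᵐᵒᵖ] R where
  toFun r := p * r
  map_add' := mul_add p
  map_smul' := by
    intro m x
    change p * (x * m.unop) = (p * x) * m.unop
    rw [mul_assoc]

theorem factor_equiv {R : Type*} [Ring R] (N : Submodule Rᵐᵒᵖ R) (p u : R)
    (hp : ∀ x y : R, p * x = p * y → x = y)
    (hN : N ≤ Submodule.span Rᵐᵒᵖ ({p * u} : Set R)) (A B : Submodule Rᵐᵒᵖ (R ⧸ N))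
    (hA : A = (Submodule.span Rᵐᵒᵖ ({p} : Set R)).map N.mkQ)
    (hB : B = (Submodule.span Rᵐᵒᵖ ({p * u} : Set R)).map N.mkQ) :
    Nonempty ((R ⧸ Submodule.span Rᵐᵒᵖ ({u} : Set R)) ≃ₗ[Rᵐᵒᵖ]
      (↥A ⧸ Submodule.comap A.subtype B)) := by
  have hmem : ∀ r : R, (N.mkQ ∘ₗ lmulOp p) r ∈ A := by
    intro r
    rw [hA]
    exact Submodule.mem_map_of_mem ((mem_span_op _ _).2 ⟨r, rfl⟩)
  let g : R →ₗ[Rᵐᵒᵖ] A := LinearMap.codRestrict A (N.mkQ ∘ₗ lmulOp p) hmem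
  let f := (Submodule.comap A.subtype B).mkQ ∘ₗ g
  have hker : Submodule.span Rᵐᵒᵖ ({u} : Set R) = LinearMap.ker f := by
    ext r
    have h1 : r ∈ LinearMap.ker f ↔ N.mkQ (p * r) ∈ B := by
      rw [LinearMap.mem_ker]
      change (Submodule.comap A.subtype B).mkQ (g r) = 0 ↔ _
      rw [Submodule.mkQ_apply, Submodule.Quotient.mk_eq_zero]
      rfl
    rw [h1, hB, mem_span_op, ← Submodule.mem_comap, Submodule.comap_map_mkQ,
      sup_eq_right.2 hN, mem_span_op]
    constructor
    · rintro ⟨s, rfl⟩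
      exact ⟨s, mul_assoc _ _ _⟩
    · rintro ⟨s, hs⟩
      exact ⟨s, hp _ _ (by rw [← mul_assoc, hs])⟩
  have hsurj : Function.Surjective f := by
    refine (Submodule.mkQ_surjective _).comp ?_
    rintro ⟨y, hy⟩
    have hy' := hy
    rw [hA] at hy'
    obtain ⟨z, hz, rfl⟩ := hy'
    obtain ⟨r, rfl⟩ := (mem_span_op _ _).1 hz
    exact ⟨r, rfl⟩
  exact ⟨(Submodule.quotEquivOfEq _ _ hker).trans (f.quotKerEquivOfSurjective hsurj)⟩

theorem isUnit_cancellative {R : Type*} [Ring R] (x : cancellativeSubmonoid R)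
    (h : IsUnit (x : R)) : IsUnit x := by
  obtain ⟨w, hw⟩ := h
  have hm : ((w⁻¹ : Rˣ) : R) ∈ cancellativeSubmonoid R :=
    ⟨fun x y h => (Units.mul_right_inj _).1 h, fun x y h => (Units.mul_left_inj _).1 h⟩
  refine ⟨⟨x, ⟨_, hm⟩, ?_, ?_⟩, rfl⟩
  · apply Subtype.ext
    simp [← hw]
  · apply Subtype.ext
    simp [← hw]

/-- If nonunit factorization lengths are bounded, there are factorizations into atoms. -/
theorem atomic_of_bound {H : Type*} [Monoid H] (a : H) (ha : ¬ IsUnit a) (B : ℕ)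
    (hB : ∀ l : List H, (∀ x ∈ l, ¬ IsUnit x) → l.prod = a → l.length ≤ B) :
    ∃ l : List H, (∀ x ∈ l, Irreducible x) ∧ l.prod = a := by
  classical
  let P : ℕ → Prop := fun k => ∃ l : List H, (∀ x ∈ l, ¬ IsUnit x) ∧ l.prod = a ∧ l.length = k
  have hP1 : P 1 := ⟨[a], by simpa using ha, by simp, rfl⟩
  have hb : 1 ≤ B := hB [a] (by simpa using ha) (by simp)
  obtain ⟨l, hl, hprod, hlen⟩ := Nat.findGreatest_spec (P := P) hb hP1
  refine ⟨l, fun x hx => ⟨hl x hx, ?_⟩, hprod⟩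
  intro y z hyz
  by_contra! hcon
  obtain ⟨s, t, rfl⟩ := List.append_of_mem hx
  have hl' : ∀ w ∈ s ++ y :: z :: t, ¬ IsUnit w := by
    intro w hw
    simp only [List.mem_append, List.mem_cons] at hw hl
    rcases hw with h | rfl | rfl | h
    · exact hl w (Or.inl h)
    · exact hcon.1
    · exact hcon.2
    · exact hl w (Or.inr (Or.inr h))
  have hp' : (s ++ y :: z :: t).prod = a := by
    rw [← hprod, hyz]
    simp [mul_assoc]
  have h1 := Nat.le_findGreatest (P := P) (hB _ hl' hp') ⟨_, hl', hp', rfl⟩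
  rw [← hlen] at h1
  simp at h1

/-- Let `R` be a left and right noetherian ring.  Suppose there
is an ordinal `α` and an isomorphism-invariant assignment `j` of an ordinal to
every (finitely generated) right `R`-module such that `j(R/xR) = α` for every
cancellative nonunit `x ∈ R`, and `j` is finitely partitive on `α`: for every
finitely generated right module `M` with `j(M) = α` there is a finite bound on
the lengths `n` of chains `M₀ ⊆ M₁ ⊆ ⋯ ⊆ Mₙ = M` of submodules with
`j(M_{i+1}/M_i) = α` for all `i`.  Then `R` is a BF-ring. -/
theorem isBFRing_of_partitive_dimension {R : Type u} [Ring R]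
    (hnl : IsNoetherian R R) (hnr : IsNoetherian Rᵐᵒᵖ R)
    (α : Ordinal.{v})
    (j : (M : Type u) → [inst : AddCommGroup M] → [inst2 : Module Rᵐᵒᵖ M] → Ordinal.{v})
    (hiso : ∀ (M N : Type u) [AddCommGroup M] [Module Rᵐᵒᵖ M]
      [AddCommGroup N] [Module Rᵐᵒᵖ N], Nonempty (M ≃ₗ[Rᵐᵒᵖ] N) → j M = j N)
    (hval : ∀ x : R, IsCancellative x → ¬ IsUnit x →
      j (R ⧸ Submodule.span Rᵐᵒᵖ ({x} : Set R)) = α)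
    (hpart : ∀ (M : Type u) [AddCommGroup M] [Module Rᵐᵒᵖ M],
      Module.Finite Rᵐᵒᵖ M → j M = α →
      ∃ B : ℕ, ∀ (n : ℕ) (c : Fin (n + 1) → Submodule Rᵐᵒᵖ M), Monotone c →
        c (Fin.last n) = ⊤ →
        (∀ i : Fin n,
          j (↥(c i.succ) ⧸ Submodule.comap (c i.succ).subtype (c i.castSucc)) = α) →
        n ≤ B) :
    IsBFRing R := by
  have key : ∀ a : cancellativeSubmonoid R, ¬ IsUnit a → ∃ B : ℕ,
      ∀ l : List (cancellativeSubmonoid R), (∀ x ∈ l, ¬ IsUnit x) → l.prod = a →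
        l.length ≤ B := by
    intro a ha
    obtain ⟨B, hB⟩ := hpart (R ⧸ Submodule.span Rᵐᵒᵖ ({(a : R)} : Set R)) inferInstance
      (hval a a.2 (fun h => ha (isUnit_cancellative a h)))
    refine ⟨B, fun l hl hprod => ?_⟩
    have hdvd : ∀ m n : ℕ, m ≤ n → Submodule.span Rᵐᵒᵖ ({((l.take n).prod : R)} : Set R) ≤
        Submodule.span Rᵐᵒᵖ ({((l.take m).prod : R)} : Set R) := by
      intro m n hmn
      rw [Submodule.span_singleton_le_iff_mem, mem_span_op]
      refine ⟨((l.take n).drop m).prod, ?_⟩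
      rw [← Submonoid.coe_mul]
      congr 1
      have := List.prod_take_mul_prod_drop (l.take n) m
      rwa [List.take_take, min_eq_left hmn] at this
    refine hB l.length (fun i => (Submodule.span Rᵐᵒᵖ
      ({((l.take (l.length - i)).prod : R)} : Set R)).map (Submodule.mkQ _)) ?_ ?_ ?_
    · intro i k hik
      apply Submodule.map_mono
      apply hdvd
      have : (i : ℕ) ≤ k := hik
      omega
    · have h1 : Submodule.span Rᵐᵒᵖ ({(1 : R)} : Set R) = ⊤ := by
        rw [eq_top_iff]
        intro x _
        exact (mem_span_op _ _).2 ⟨x, one_mul x⟩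
      simp [h1]
    · intro i
      have hi := i.2
      have hk : l.length - (i.succ : Fin _) < l.length := by
        simp only [Fin.val_succ]; omega
      set k := l.length - ((i.succ : Fin _) : ℕ) with hkdef
      have hk' : l.length - ((i.castSucc : Fin _) : ℕ) = k + 1 := by
        simp only [Fin.val_succ, Fin.val_castSucc] at *; omega
      have hpr : ((l.take (k + 1)).prod : R) = ((l.take k).prod : R) * (l[k] : R) := by
        rw [← Submonoid.coe_mul, List.prod_take_succ]
      have hu : ¬ IsUnit (l[k]) := hl _ (List.getElem_mem hk)
      rw [← hval (l[k]) (l[k]).2 (fun h => hu (isUnit_cancellative _ h))]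
      refine (hiso _ _ (factor_equiv _ ((l.take k).prod : R) (l[k] : R)
        (l.take k).prod.2.1 ?_ _ _ ?_ ?_)).symm
      · rw [← hpr]
        have := hdvd (k + 1) l.length hk
        rwa [List.take_length, hprod] at this
      · rfl
      · rw [hk', hpr]
  refine ⟨fun a ha => ?_, fun a => ?_⟩
  · obtain ⟨B, hB⟩ := key a ha
    exact atomic_of_bound a ha B hB
  · by_cases ha : IsUnit a
    · refine (Set.finite_singleton 0).subset ?_
      rintro k ⟨l, hl, hprod, rfl⟩
      cases l with
      | nil => rfl
      | cons x t =>
        exfalso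
        apply (hl x (by simp)).1
        obtain ⟨b, hb⟩ := ha.exists_right_inv
        rw [← hprod, List.prod_cons, mul_assoc] at hb
        have h2 : (t.prod * b) * x = 1 := by
          apply Subtype.ext
          apply x.2.1
          have h3 : x * ((t.prod * b) * x) = x * 1 := by
            rw [← mul_assoc, hb, one_mul, mul_one]
          exact congrArg Subtype.val h3
        exact ⟨⟨x, _, hb, h2⟩, rfl⟩
    · obtain ⟨B, hB⟩ := key a ha
      refine (Set.finite_Iic B).subset ?_
      rintro k ⟨l, hl, hprod, rfl⟩
      exact hB l (fun x hx => (hl x hx).1) hprod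
end

section
/- Every commutative noetherian ring R is a BF-ring, i.e., the multiplicative monoid of non-zero-divisors of R is a BF-monoid. -/
theorem BF_bound_atomic {H : Type*} [CommMonoid H] (N : ℕ) : ∀ a : H,
    (∀ l : List H, (∀ x ∈ l, ¬ IsUnit x) → l.prod = a → l.length ≤ N) → ¬ IsUnit a →
    ∃ l : List H, (∀ x ∈ l, Irreducible x) ∧ l.prod = a := by
  induction N with
  | zero =>
    intro a h ha
    have := h [a] (by simpa using ha) (by simp)
    simp at this
  | succ N ih =>
    intro a h ha
    by_cases hi : Irreducible a
    · exact ⟨[a], by simpa using hi, by simp⟩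
    · rw [irreducible_iff] at hi
      push Not at hi
      obtain ⟨b, c, hbc, hb, hc⟩ := hi ha
      obtain ⟨l1, h1, p1⟩ := ih b (fun l hl hp => by
        have := h (c :: l) (by simpa using ⟨hc, hl⟩) (by simp [hp, hbc, mul_comm])
        simpa using this) hb
      obtain ⟨l2, h2, p2⟩ := ih c (fun l hl hp => by
        have := h (b :: l) (by simpa using ⟨hb, hl⟩) (by simp [hp, hbc])
        simpa using this) hc
      refine ⟨l1 ++ l2, ?_, by simp [p1, p2, hbc]⟩
      intro x hx
      rcases List.mem_append.1 hx with hx | hx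
      exacts [h1 x hx, h2 x hx]

theorem BF_prod_mem {R A : Type*} [CommRing R] [CommRing A] (f : R →+* A) (P : Ideal R)
    (I : Ideal A) (hP : ∀ x ∈ P, f x ∈ I) [DecidablePred (· ∈ P)] (l : List R) :
    f l.prod ∈ I ^ (l.countP (fun x => decide (x ∈ P))) := by
  induction l with
  | nil => simp
  | cons u l ih =>
    rw [List.prod_cons, map_mul, List.countP_cons]
    by_cases hu : u ∈ P
    · simp only [hu, decide_true, if_true]
      rw [pow_succ, mul_comm (f u)]
      exact Ideal.mul_mem_mul ih (hP u hu)
    · simp only [hu, decide_false]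
      exact Ideal.mul_mem_left _ _ ih

theorem BF_length_le {R ι : Type*} (S : Finset ι) (p : ι → R → Prop)
    [∀ i, DecidablePred (p i)] (l : List R) (h : ∀ x ∈ l, ∃ i ∈ S, p i x) :
    l.length ≤ ∑ i ∈ S, l.countP (fun x => decide (p i x)) := by
  induction l with
  | nil => simp
  | cons u l ih =>
    have := ih (fun x hx => h x (by simp [hx]))
    simp only [List.countP_cons, List.length_cons, Finset.sum_add_distrib]
    obtain ⟨i, hi, hp⟩ := h u (by simp)
    have h1 : (if decide (p i u) = true then 1 else 0) ≤
        ∑ i ∈ S, (if decide (p i u) = true then 1 else 0) :=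
      Finset.single_le_sum (f := fun i => if decide (p i u) = true then 1 else 0)
        (fun _ _ => Nat.zero_le _) hi
    simp only [hp, decide_true, if_true] at h1
    omega

theorem BF_exists_pow {R : Type*} [CommRing R] [IsNoetherianRing R] (a : R)
    (ha : ∀ x, a * x = 0 → x = 0) (P : Ideal R) [P.IsPrime] :
    ∃ N, algebraMap R (Localization.AtPrime P) a ∉
      (IsLocalRing.maximalIdeal (Localization.AtPrime P)) ^ N := by
  haveI : IsNoetherianRing (Localization.AtPrime P) :=
    IsLocalization.isNoetherianRing P.primeCompl _ inferInstance
  by_contra! h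
  have h0 : algebraMap R (Localization.AtPrime P) a = 0 := by
    have := Ideal.iInf_pow_eq_bot_of_isLocalRing
      (IsLocalRing.maximalIdeal (Localization.AtPrime P)) Ideal.IsPrime.ne_top'
    rw [← Ideal.mem_bot, ← this]
    simpa [Ideal.mem_iInf] using h
  rw [IsLocalization.map_eq_zero_iff P.primeCompl] at h0
  obtain ⟨m, hm⟩ := h0
  have := ha m (by rw [mul_comm]; exact hm)
  exact m.2 (by rw [this]; exact P.zero_mem)

theorem BF_bound {R : Type*} [CommRing R] [IsNoetherianRing R] (a : R)
    (ha : ∀ x, a * x = 0 → x = 0) :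
    ∃ N, ∀ l : List R, (∀ x ∈ l, ¬ IsUnit x) → l.prod = a → l.length ≤ N := by
  classical
  let M := R ⧸ Ideal.span {a}
  have hfin : (associatedPrimes R M).Finite := associatedPrimes.finite R M
  have key : ∀ P : Ideal R, ∃ N, P ∈ associatedPrimes R M →
      ∀ l : List R, l.prod = a → l.countP (fun x => decide (x ∈ P)) ≤ N := by
    intro P
    by_cases hP : P ∈ associatedPrimes R M
    · haveI : P.IsPrime := hP.isPrime
      obtain ⟨N, hN⟩ := BF_exists_pow a ha P
      refine ⟨N, fun _ l hl => ?_⟩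
      by_contra! hlt
      apply hN
      have := BF_prod_mem (algebraMap R (Localization.AtPrime P)) P
        (IsLocalRing.maximalIdeal (Localization.AtPrime P))
        (fun x hx => (IsLocalization.AtPrime.to_map_mem_maximal_iff _ P x).2 hx) l
      rw [hl] at this
      exact Ideal.pow_le_pow_right hlt.le this
    · exact ⟨0, fun h => absurd h hP⟩
  choose N hN using key
  refine ⟨∑ P ∈ hfin.toFinset, N P, fun l hl hp => ?_⟩
  refine (BF_length_le hfin.toFinset (fun P x => x ∈ P) l ?_).trans
    (Finset.sum_le_sum fun P hP => hN P (by simpa using hP) l hp)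
  intro u hu
  obtain ⟨b, hb⟩ := List.dvd_prod hu
  rw [hp] at hb
  have hnb : (Ideal.Quotient.mk (Ideal.span {a}) b : M) ≠ 0 := by
    intro h
    rw [Ideal.Quotient.eq_zero_iff_mem, Ideal.mem_span_singleton] at h
    obtain ⟨t, ht⟩ := h
    apply hl u hu
    have h1 : a * (1 - u * t) = 0 := by
      have : a = u * (a * t) := by rw [← ht]; exact hb
      linear_combination this
    have := ha _ h1
    exact IsUnit.of_mul_eq_one t (by linear_combination -this)
  obtain ⟨P, hP, hle⟩ := exists_le_isAssociatedPrime_of_isNoetherianRing R _ hnb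
  refine ⟨P, hfin.mem_toFinset.2 hP, hle ?_⟩
  have h2 : u • (Ideal.Quotient.mk (Ideal.span {a}) b : M) = 0 := by
    change Ideal.Quotient.mk (Ideal.span {a}) (u * b) = 0
    rw [Ideal.Quotient.eq_zero_iff_mem, ← hb]
    exact Ideal.mem_span_singleton_self a
  simpa [Submodule.mem_colon_singleton] using h2

/-- Every commutative noetherian ring is a BF-ring: its monoid
of non-zero-divisors (equivalently, cancellative elements) is a BF-monoid. -/
theorem isBFRing_of_commNoetherian (R : Type*) [CommRing R] [IsNoetherianRing R] :
    IsBFRing R := by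
  have unit_of : ∀ x : cancellativeSubmonoid R, IsUnit (x : R) → IsUnit x := by
    rintro x ⟨u, hu⟩
    have hc : ((u⁻¹ : Rˣ) : R) ∈ cancellativeSubmonoid R :=
      ⟨fun x y h => by simpa using h, fun x y h => by simpa using h⟩
    exact IsUnit.of_mul_eq_one ⟨_, hc⟩ (Subtype.ext (by simp [← hu]))
  have bound : ∀ a : cancellativeSubmonoid R, ∃ N, ∀ l : List (cancellativeSubmonoid R),
      (∀ x ∈ l, ¬ IsUnit x) → l.prod = a → l.length ≤ N := by
    intro a
    obtain ⟨N, hN⟩ := BF_bound (a : R) (fun x hx => a.2.1 x 0 (by simpa using hx))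
    refine ⟨N, fun l hl hp => ?_⟩
    have := hN (l.map (cancellativeSubmonoid R).subtype) (by
      intro x hx
      obtain ⟨y, hy, rfl⟩ := List.mem_map.1 hx
      exact fun h => hl y hy (unit_of y h)) (by
      rw [← map_list_prod, hp]; rfl)
    simpa using this
  refine ⟨fun a ha => ?_, fun a => ?_⟩
  · obtain ⟨N, hN⟩ := bound a
    exact BF_bound_atomic N a hN ha
  · obtain ⟨N, hN⟩ := bound a
    refine (Set.finite_Iic N).subset ?_
    rintro k ⟨l, hl, hp, rfl⟩
    exact hN l (fun x hx => (hl x hx).not_isUnit) hp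
end

section
/- Let F be the free group on two generators b and c, let α be the automorphism of F with α(b) = c and α(c) = b⁻¹, and let G = F ⋊_α ℤ be the semidirect product in which the generator 1 of ℤ acts on F by α. Set a := (1_F, 1) ∈ G and identify b with (b, 0) ∈ G. Then the submonoid of G generated by a and b is isomorphic to the monoid presented by ⟨a, b ∣ ba²b = a², a⁴b = ba⁴⟩, via the isomorphism sending the generators of the presented monoid to a and b respectively. Equivalently, the monoid homomorphism from the free monoid on two generators to G sending the first generator to a and the second to b induces an injective homomorphism from the presented monoid to G. -/
namespace PaperExample

/-- The generator `b` of the free group on two generators. -/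
def bF : FreeGroup Bool := FreeGroup.of false

/-- The generator `c` of the free group on two generators. -/
def cF : FreeGroup Bool := FreeGroup.of true

/-- The endomorphism of the free group with `b ↦ c`, `c ↦ b⁻¹`. -/
def alphaHom : FreeGroup Bool →* FreeGroup Bool :=
  FreeGroup.lift fun t => if t then bF⁻¹ else cF

/-- The endomorphism of the free group with `b ↦ c⁻¹`, `c ↦ b`. -/
def alphaInvHom : FreeGroup Bool →* FreeGroup Bool :=
  FreeGroup.lift fun t => if t then bF else cF⁻¹

lemma alphaInvHom_comp_alphaHom : alphaInvHom.comp alphaHom = MonoidHom.id _ := by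
  apply FreeGroup.ext_hom
  intro t
  cases t <;> simp [alphaHom, alphaInvHom, bF, cF]

lemma alphaHom_comp_alphaInvHom : alphaHom.comp alphaInvHom = MonoidHom.id _ := by
  apply FreeGroup.ext_hom
  intro t
  cases t <;> simp [alphaHom, alphaInvHom, bF, cF]

/-- The automorphism `α` of the free group `F` on `b, c`, with `α(b) = c` and
`α(c) = b⁻¹`. -/
def alphaAut : MulAut (FreeGroup Bool) :=
  MonoidHom.toMulEquiv alphaHom alphaInvHom alphaInvHom_comp_alphaHom
    alphaHom_comp_alphaInvHom

/-- The semidirect product `G = F ⋊_α ℤ`, where the generator `1` of `ℤ` acts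
by `α`; the multiplication is `(f, m)(g, n) = (f · α^m(g), m + n)`. -/
abbrev G : Type :=
  SemidirectProduct (FreeGroup Bool) (Multiplicative ℤ)
    (zpowersHom (MulAut (FreeGroup Bool)) alphaAut)

/-- The element `a = (1_F, 1) ∈ G`. -/
def aG : G := SemidirectProduct.inr (Multiplicative.ofAdd 1)

/-- The element `b = (b, 0) ∈ G`. -/
def bG : G := SemidirectProduct.inl bF

/-- The defining relations of the presented monoid
`⟨a, b ∣ ba²b = a², a⁴b = ba⁴⟩`, on the free monoid on two generators where
`false` stands for `a` and `true` stands for `b`. -/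
def presRel : FreeMonoid Bool → FreeMonoid Bool → Prop := fun x y =>
  (x = FreeMonoid.of true * FreeMonoid.of false ^ 2 * FreeMonoid.of true ∧
    y = FreeMonoid.of false ^ 2) ∨
  (x = FreeMonoid.of false ^ 4 * FreeMonoid.of true ∧
    y = FreeMonoid.of true * FreeMonoid.of false ^ 4)

/-- The congruence on the free monoid generated by the relations
`ba²b = a²` and `a⁴b = ba⁴`. -/
def presCon : Con (FreeMonoid Bool) := conGen presRel

/-- The monoid `S` presented by `⟨a, b ∣ ba²b = a², a⁴b = ba⁴⟩`. -/
abbrev PresentedS : Type := presCon.Quotient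

/-- The monoid homomorphism from the free monoid on two generators to `G`
sending the first generator (`false`) to `a` and the second (`true`) to `b`. -/
def phi : FreeMonoid Bool →* G := FreeMonoid.lift fun t => if t then bG else aG

def sa : PresentedS := presCon.mk' (FreeMonoid.of false)

def sb : PresentedS := presCon.mk' (FreeMonoid.of true)

lemma rel1 : sb * sa ^ 2 * sb = sa ^ 2 := by
  have h : presCon (FreeMonoid.of true * FreeMonoid.of false ^ 2 * FreeMonoid.of true)
      (FreeMonoid.of false ^ 2) := ConGen.Rel.of _ _ (Or.inl ⟨rfl, rfl⟩)
  have := (Con.eq presCon).2 h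
  exact this

lemma rel2 : sa ^ 4 * sb = sb * sa ^ 4 := by
  have h : presCon (FreeMonoid.of false ^ 4 * FreeMonoid.of true)
      (FreeMonoid.of true * FreeMonoid.of false ^ 4) := ConGen.Rel.of _ _ (Or.inr ⟨rfl, rfl⟩)
  have := (Con.eq presCon).2 h
  exact this

lemma rel2' (q : ℕ) : sa ^ (4 * q) * sb = sb * sa ^ (4 * q) := by
  rw [pow_mul]
  exact (Commute.pow_left (show Commute (sa ^ 4) sb from rel2) q)

lemma pow_b (k : ℕ) : sa ^ k * sb = sa ^ (k % 4) * sb * sa ^ (4 * (k / 4)) := by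
  conv_lhs => rw [← Nat.mod_add_div k 4, pow_add, mul_assoc, rel2', ← mul_assoc]

def lst : List (ZMod 4) → ZMod 4
  | [] => 0
  | y :: _ => y

def NF : List (ZMod 4) → PresentedS
  | [] => 1
  | x :: l => NF l * sa ^ (x - lst l).val * sb

def Red (L : List (ZMod 4)) : Prop := L.IsChain (fun x y => x ≠ y + 2)

lemma exists_nf (w : FreeMonoid Bool) : ∀ L k, Red L → ∃ L' k', Red L' ∧
    NF L * sa ^ k * presCon.mk' w = NF L' * sa ^ k' := by
  induction w using FreeMonoid.inductionOn' with
  | one => intro L k h; exact ⟨L, k, h, by simp⟩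
  | of_mul t w ih =>
    intro L k h
    cases t with
    | false =>
      obtain ⟨L', k', h', e⟩ := ih L (k+1) h
      refine ⟨L', k', h', ?_⟩
      rw [← e, map_mul, pow_succ]
      simp only [mul_assoc]
      rfl
    | true =>
      suffices H : ∃ L1 k1, Red L1 ∧ NF L * sa ^ k * sb = NF L1 * sa ^ k1 by
        obtain ⟨L1, k1, h1, e1⟩ := H
        obtain ⟨L', k', h', e⟩ := ih L1 k1 h1
        refine ⟨L', k', h', ?_⟩
        rw [← e, map_mul, ← e1]
        simp only [mul_assoc]
        rfl
      have hv : ((k : ZMod 4)).val = k % 4 := ZMod.val_natCast 4 k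
      have hgen : NF L * sa ^ k * sb = NF ((lst L + k) :: L) * sa ^ (4 * (k / 4)) := by
        rw [NF, add_sub_cancel_left, hv, mul_assoc, pow_b]
        simp only [mul_assoc]
      cases L with
      | nil => exact ⟨_, _, by simp [Red], hgen⟩
      | cons y l =>
        by_cases hk : (k : ZMod 4) = 2
        · refine ⟨l, (y - lst l).val + 2 + 4 * (k / 4), ?_, ?_⟩
          · exact List.IsChain.tail h
          · have h2 : k % 4 = 2 := by rw [← hv, hk]; rfl
            rw [mul_assoc, pow_b, h2, NF, pow_add, pow_add]
            conv_rhs => rw [← rel1]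
            simp only [mul_assoc]
        · refine ⟨_, _, ?_, hgen⟩
          unfold Red at *
          rw [List.isChain_cons_cons]
          exact ⟨by simpa [lst] using hk, h⟩

/-- Letters. -/
def X (x : ZMod 4) : FreeGroup Bool :=
  if x = 0 then bF else if x = 1 then cF else if x = 2 then bF⁻¹ else cF⁻¹

def enc (x : ZMod 4) : Bool × Bool :=
  if x = 0 then (false, false) else if x = 1 then (true, false) else
  if x = 2 then (false, true) else (true, true)

lemma enc_inj : Function.Injective enc := by unfold Function.Injective; decide

lemma enc_red : ∀ x y : ZMod 4, x ≠ y + 2 → (enc x).1 = (enc y).1 → (enc x).2 = (enc y).2 := by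
  decide

lemma alpha_b : alphaAut bF = cF := by
  change alphaHom bF = cF
  simp [alphaHom, bF]

lemma alpha_c : alphaAut cF = bF⁻¹ := by
  change alphaHom cF = bF⁻¹
  simp [alphaHom, cF]

lemma alpha_X (x : ZMod 4) : alphaAut (X x) = X (x + 1) := by
  have : ∀ x : ZMod 4, x = 0 ∨ x = 1 ∨ x = 2 ∨ x = 3 := by decide
  have e0 : X 0 = bF := rfl
  have e1 : X 1 = cF := rfl
  have e2 : X 2 = bF⁻¹ := rfl
  have e3 : X 3 = cF⁻¹ := rfl
  rcases this x with rfl | rfl | rfl | rfl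
  · rw [show (0 : ZMod 4) + 1 = 1 from rfl, e0, e1, alpha_b]
  · rw [show (1 : ZMod 4) + 1 = 2 from rfl, e2, e1, alpha_c]
  · rw [show (2 : ZMod 4) + 1 = 3 from rfl, e2, e3, map_inv, alpha_b]
  · rw [show (3 : ZMod 4) + 1 = 0 from rfl, e3, e0, map_inv, alpha_c, inv_inv]

lemma alpha_pow (n : ℕ) : (alphaAut ^ n) bF = X n := by
  induction n with
  | zero => simp [X]
  | succ n ih => rw [pow_succ', MulAut.mul_apply, ih, alpha_X]; push_cast; rfl

lemma aG_pow (n : ℕ) : aG ^ n = SemidirectProduct.inr (Multiplicative.ofAdd (n : ℤ)) := by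
  rw [aG, ← map_pow, ← ofAdd_nsmul]; simp

lemma psi_nf (ψ : PresentedS →* G) (ha : ψ sa = aG) (hb : ψ sb = bG) (L : List (ZMod 4)) :
    (∃ n : ℕ, (ψ (NF L)).right = Multiplicative.ofAdd (n : ℤ) ∧ (n : ZMod 4) = lst L) ∧
    (ψ (NF L)).left⁻¹ = FreeGroup.mk (L.map enc) := by
  induction L with
  | nil => exact ⟨⟨0, by simp [NF], by simp [lst]⟩, by simp [NF]; rfl⟩
  | cons x l ih =>
    obtain ⟨⟨n, h1, h2⟩, h3⟩ := ih
    have hx : ((n + (x - lst l).val : ℕ) : ZMod 4) = x := by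
      push_cast
      rw [ZMod.natCast_zmod_val, h2]; ring
    refine ⟨⟨n + (x - lst l).val, ?_, hx⟩, ?_⟩
    · simp [NF, ha, hb, aG_pow, bG, h1]
    · have : (ψ (NF (x :: l))).left = (ψ (NF l)).left * X x := by
        rw [NF, map_mul, map_mul, map_pow, ha, hb, aG_pow, bG]
        simp only [SemidirectProduct.mul_left, SemidirectProduct.mul_right,
          SemidirectProduct.left_inl, SemidirectProduct.left_inr, map_one, mul_one, h1,
          SemidirectProduct.right_inr]
        rw [← ofAdd_add, ← Nat.cast_add, zpowersHom_apply, toAdd_ofAdd, zpow_natCast, alpha_pow, hx]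
      rw [this, mul_inv_rev, h3]
      have hX : ∀ x, (X x)⁻¹ = FreeGroup.mk [enc x] := by
        have : ∀ x : ZMod 4, x = 0 ∨ x = 1 ∨ x = 2 ∨ x = 3 := by decide
        intro x
        rcases this x with rfl | rfl | rfl | rfl <;> rfl
      rw [hX, FreeGroup.mul_mk]
      rfl

lemma red_inj {L L' : List (ZMod 4)} (h : Red L) (h' : Red L')
    (e : FreeGroup.mk (L.map enc) = FreeGroup.mk (L'.map enc)) : L = L' := by
  have key : ∀ L, Red L → FreeGroup.IsReduced (L.map enc) := by
    intro L h
    unfold FreeGroup.IsReduced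
    rw [List.isChain_map]
    exact List.IsChain.imp (fun x y => enc_red x y) h
  have e2 := congrArg FreeGroup.toWord e
  rw [FreeGroup.toWord_mk, FreeGroup.toWord_mk, (key L h).reduce_eq, (key L' h').reduce_eq] at e2
  exact List.map_injective_iff.2 enc_inj e2

lemma pres_le : presCon ≤ Con.ker phi := by
  refine Con.conGen_le.2 ?_
  have hpa : phi (FreeMonoid.of false) = aG := by simp [phi]
  have hpb : phi (FreeMonoid.of true) = bG := by simp [phi]
  have e0 : ((0:ℕ) : ZMod 4) = 0 := rfl
  have x2 : (alphaAut ^ 2) bF = bF⁻¹ := alpha_pow 2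
  have x4 : (alphaAut ^ 4) bF = bF := alpha_pow 4
  have z2 : zpowersHom (MulAut (FreeGroup Bool)) alphaAut (Multiplicative.ofAdd ((2:ℕ):ℤ)) bF
      = bF⁻¹ := by rw [zpowersHom_apply, toAdd_ofAdd, zpow_natCast, x2]
  have z4 : zpowersHom (MulAut (FreeGroup Bool)) alphaAut (Multiplicative.ofAdd ((4:ℕ):ℤ)) bF
      = bF := by rw [zpowersHom_apply, toAdd_ofAdd, zpow_natCast, x4]
  rintro x y (⟨rfl, rfl⟩ | ⟨rfl, rfl⟩)
  · rw [Con.ker_rel]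
    simp only [map_mul, map_pow, hpa, hpb]
    rw [aG_pow, bG]
    ext1
    · simp only [SemidirectProduct.mul_left, SemidirectProduct.mul_right,
          SemidirectProduct.left_inl, SemidirectProduct.left_inr, map_one, mul_one, 
          SemidirectProduct.right_inr, SemidirectProduct.right_inl, one_mul, z2, mul_inv_cancel]
    · simp
  · rw [Con.ker_rel]
    simp only [map_mul, map_pow, hpa, hpb]
    rw [aG_pow, bG]
    ext1
    · simp only [SemidirectProduct.mul_left, SemidirectProduct.mul_right,
          SemidirectProduct.left_inl, SemidirectProduct.left_inr, map_one, mul_one, 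
          SemidirectProduct.right_inr, SemidirectProduct.right_inl, one_mul, z4]
    · simp

/-- The monoid homomorphism from the free monoid on two
generators to `G = F ⋊_α ℤ` sending the generators to `a` and `b` induces an
injective monoid homomorphism from the presented monoid
`⟨a, b ∣ ba²b = a², a⁴b = ba⁴⟩` to `G`, whose range is the submonoid of `G`
generated by `a` and `b`; i.e. the presented monoid is isomorphic to that
submonoid. -/
theorem presentedMonoid_embeds :
    ∃ ψ : PresentedS →* G,
      (∀ w : FreeMonoid Bool, ψ (presCon.mk' w) = phi w) ∧
      Function.Injective ψ ∧
      MonoidHom.mrange ψ = Submonoid.closure {aG, bG} := by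
  have hpa : phi (FreeMonoid.of false) = aG := by simp [phi]
  have hpb : phi (FreeMonoid.of true) = bG := by simp [phi]
  let ψ : PresentedS →* G := presCon.lift phi pres_le
  have hψ : ∀ w : FreeMonoid Bool, ψ (presCon.mk' w) = phi w := fun w => rfl
  have ha : ψ sa = aG := hpa
  have hb : ψ sb = bG := hpb
  refine ⟨ψ, hψ, ?_, ?_⟩
  · have key : ∀ s : PresentedS, ∃ L k, Red L ∧ s = NF L * sa ^ k := by
      intro s
      obtain ⟨w, rfl⟩ := Con.mk'_surjective s
      obtain ⟨L, k, h, e⟩ := exists_nf w [] 0 (by simp [Red])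
      exact ⟨L, k, h, by rw [← e]; simp [NF]⟩
    intro s t hst
    obtain ⟨L, k, h, rfl⟩ := key s
    obtain ⟨L', k', h', rfl⟩ := key t
    rw [map_mul, map_mul, map_pow, map_pow, ha, aG_pow, aG_pow] at hst
    have hl := congrArg SemidirectProduct.left hst
    simp only [SemidirectProduct.mul_left, SemidirectProduct.left_inr, map_one, mul_one] at hl
    have hL : L = L' := by
      apply red_inj h h'
      rw [← (psi_nf ψ ha hb L).2, ← (psi_nf ψ ha hb L').2, hl]
    subst hL
    have hr := SemidirectProduct.inr_injective (mul_left_cancel hst)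
    have : k = k' := by exact_mod_cast Multiplicative.ofAdd.injective hr
    rw [this]
  · have h1 : MonoidHom.mrange ψ = MonoidHom.mrange phi := by
      ext g
      constructor
      · rintro ⟨s, rfl⟩
        obtain ⟨w, rfl⟩ := Con.mk'_surjective s
        exact ⟨w, rfl⟩
      · rintro ⟨w, rfl⟩
        exact ⟨presCon.mk' w, rfl⟩
    rw [h1, phi, FreeMonoid.mrange_lift]
    congr 1
    ext g
    simp [eq_comm, or_comm]

end PaperExample
end
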